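/- arXiv:1704.03646 — 2 statements merged into one kernel-verified Lean document; each statement's English description precedes it below -/
import Mathlib

section
/- One-dimensional discrete entropy conservation of the two-point-flux volume term: let N ≥ 1 and let Q be an SBP matrix with zero row sums. Let W, F, Fent : {0,…,N} → ℝ, set Ψ_i = W_i F_i − Fent_i, and let Fec : {0,…,N} × {0,…,N} → ℝ be symmetric (Fec(i,m) = Fec(m,i)), consistent (Fec(i,i) = F_i), and satisfy the entropy-conservation condition Fec(i,m)·(W_i − W_m) = Ψ_i − Ψ_m for all i, m. Then Σ_{i=0}^N W_i · 2·Σ_{m=0}^N Q_{im}·Fec(i,m) = Fent_N − Fent_0, i.e. the volume contribution telescopes exactly to the boundary entropy flux. -/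
open Matrix

/-- The SBP boundary matrix `B = diag(−1, 0, …, 0, 1)`. -/
def sbpBoundaryMatrix (N : ℕ) : Matrix (Fin (N + 1)) (Fin (N + 1)) ℝ :=
  Matrix.of fun i j =>
    if i = j then (if (i : ℕ) = 0 then -1 else if (i : ℕ) = N then 1 else 0) else 0

/-- Double sums weighted by the SBP boundary matrix reduce to a difference of boundary values. -/
theorem sum_sbpBoundaryMatrix_mul {N : ℕ} (hN : 1 ≤ N) (g : Fin (N + 1) → Fin (N + 1) → ℝ) :
    ∑ i, ∑ m, sbpBoundaryMatrix N i m * g i m = g (Fin.last N) (Fin.last N) - g 0 0 := by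
  obtain ⟨n, rfl⟩ : ∃ n, N = n + 1 := ⟨N - 1, by omega⟩
  have hdiag : ∀ i, ∑ m, sbpBoundaryMatrix (n + 1) i m * g i m =
      (if (i : ℕ) = 0 then -1 else if (i : ℕ) = n + 1 then 1 else 0) * g i i := fun i => by
    simp [sbpBoundaryMatrix]
  simp_rw [hdiag]
  rw [Fin.sum_univ_succ, Fin.sum_univ_castSucc]
  have hinner : ∀ k : Fin n, (k : ℕ) ≠ n := fun k => k.isLt.ne
  simp [hinner]
  ring

/-- Summation by parts: symmetrizing a double sum weighted by an SBP matrix leaves only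
boundary values. -/
theorem sum_sbp_mul_add_swap {N : ℕ} (hN : 1 ≤ N)
    {Q : Matrix (Fin (N + 1)) (Fin (N + 1)) ℝ} (hSBP : Q + Qᵀ = sbpBoundaryMatrix N)
    (g : Fin (N + 1) → Fin (N + 1) → ℝ) :
    ∑ i, ∑ m, Q i m * g i m + ∑ i, ∑ m, Q i m * g m i =
      g (Fin.last N) (Fin.last N) - g 0 0 := by
  rw [← sum_sbpBoundaryMatrix_mul hN g, Finset.sum_comm (f := fun i m => Q i m * g m i)]
  simp only [← Finset.sum_add_distrib, ← hSBP, Matrix.add_apply, Matrix.transpose_apply, add_mul]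

/-- One-dimensional discrete entropy conservation of the two-point-flux volume term:
for an SBP matrix `Q` with zero row sums and a symmetric, consistent, entropy
conservative two-point flux `Fec`, the volume term telescopes exactly to the boundary
entropy flux. -/
theorem oneD_discrete_entropy_conservation (N : ℕ) (hN : 1 ≤ N)
    (Q : Matrix (Fin (N + 1)) (Fin (N + 1)) ℝ)
    (hSBP : Q + Qᵀ = sbpBoundaryMatrix N)
    (hrow : ∀ i, ∑ m, Q i m = 0)
    (W F Fent : Fin (N + 1) → ℝ)
    (Ψ : Fin (N + 1) → ℝ) (hΨ : ∀ i, Ψ i = W i * F i - Fent i)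
    (Fec : Fin (N + 1) → Fin (N + 1) → ℝ)
    (hsym : ∀ i m, Fec i m = Fec m i)
    (hcons : ∀ i, Fec i i = F i)
    (hec : ∀ i m, Fec i m * (W i - W m) = Ψ i - Ψ m) :
    ∑ i, W i * (2 * ∑ m, Q i m * Fec i m) = Fent (Fin.last N) - Fent 0 := by
  have hsymm := sum_sbp_mul_add_swap hN hSBP fun i m => W i * Fec i m
  have hpot := sum_sbp_mul_add_swap hN hSBP fun i _ => Ψ i
  have hzero : ∑ i, ∑ m, Q i m * Ψ i = 0 := by
    simp_rw [← Finset.sum_mul, hrow, zero_mul, Finset.sum_const_zero]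
  have hdiff : ∑ i, ∑ m, Q i m * (W i * Fec i m) - ∑ i, ∑ m, Q i m * (W m * Fec m i) =
      ∑ i, ∑ m, Q i m * Ψ i - ∑ i, ∑ m, Q i m * Ψ m := by
    simp only [← Finset.sum_sub_distrib]
    refine Finset.sum_congr rfl fun i _ => Finset.sum_congr rfl fun m _ => ?_
    rw [hsym m i]
    linear_combination Q i m * hec i m
  have hvol : ∑ i, W i * (2 * ∑ m, Q i m * Fec i m) =
      2 * ∑ i, ∑ m, Q i m * (W i * Fec i m) := by
    simp only [Finset.mul_sum]
    refine Finset.sum_congr rfl fun i _ => Finset.sum_congr rfl fun m _ => ?_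
    ring
  simp only [hcons, hΨ] at hsymm hpot hdiff hzero
  linarith
end

section
/- Three-dimensional curvilinear discrete entropy conservation: let N ≥ 1, let ω_0,…,ω_N > 0, and let D ∈ ℝ^{(N+1)×(N+1)} be such that Q with Q_{im} = ω_i D_{im} is an SBP matrix with zero row sums. Let n ≥ 1 and, for each node (i,j,k) ∈ {0,…,N}³, let W(i,j,k) ∈ ℝⁿ be a state, for each direction d ∈ {1,2,3} let F^d(i,j,k) ∈ ℝⁿ be a Cartesian flux and Fent^d(i,j,k) ∈ ℝ an entropy flux, set Ψ^d(i,j,k) = W(i,j,k)·F^d(i,j,k) − Fent^d(i,j,k), and let Ja^1, Ja^2, Ja^3 : {0,…,N}³ → ℝ³ be metric vectors. For each d ∈ {1,2,3} let Fec^d be a two-point flux on pairs of nodes that is symmetric (Fec^d(α,β) = Fec^d(β,α)), consistent (Fec^d(α,α) = F^d(α)), and entropy conservative: Fec^d(α,β)·(W(α) − W(β)) = Ψ^d(α) − Ψ^d(β) for all nodes α, β. Assume the discrete metric identities: for every d ∈ {1,2,3} and every node (i,j,k), Σ_{m=0}^N [ D_{im}·(Ja^1)_d(m,j,k) + D_{jm}·(Ja^2)_d(i,m,k)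 + D_{km}·(Ja^3)_d(i,j,m) ] = 0. Then Σ_{i,j,k} ω_i ω_j ω_k · W(i,j,k) · { 2Σ_m D_{im} Σ_d ½[(Ja^1)_d(i,j,k)+(Ja^1)_d(m,j,k)]·Fec^d((i,j,k),(m,j,k)) + 2Σ_m D_{jm} Σ_d ½[(Ja^2)_d(i,j,k)+(Ja^2)_d(i,m,k)]·Fec^d((i,j,k),(i,m,k)) + 2Σ_m D_{km} Σ_d ½[(Ja^3)_d(i,j,k)+(Ja^3)_d(i,j,m)]·Fec^d((i,j,k),(i,j,m)) } = Σ_{j,k} ω_j ω_k Σ_d [ (Ja^1)_d(N,j,k)·Fent^d(N,j,k) − (Ja^1)_d(0,j,k)·Fent^d(0,j,k) ] + Σ_{i,k} ω_i ω_k Σ_d [ (Ja^2)_d(i,N,k)·Fent^d(i,N,k) − (Ja^2)_d(i,0,k)·Fent^d(i,0,k) ] + Σ_{i,j} ω_i ω_j Σ_d [ (Ja^3)_d(i,j,N)·Fent^d(i,j,N) − (Ja^3)_d(i,j,0)·Fent^d(i,j,0) ]; that is, the entropy-projected volume term equals exactly the discrete surface integral of the contravariant entropy flux. -/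
open Matrix

theorem sum_sum_sbpBoundaryMatrix_mul {N : ℕ} (hN : 1 ≤ N)
    (h : Fin (N + 1) → Fin (N + 1) → ℝ) :
    ∑ i, ∑ m, sbpBoundaryMatrix N i m * h i m = h (Fin.last N) (Fin.last N) - h 0 0 := by
  have hdiag : ∀ i, ∑ m, sbpBoundaryMatrix N i m * h i m
      = (if i = Fin.last N then h i i else 0) - (if i = 0 then h i i else 0) := by
    intro i
    rw [Finset.sum_eq_single i (fun m _ hm => by simp [sbpBoundaryMatrix, hm.symm]) (by simp)]
    simp only [sbpBoundaryMatrix, Matrix.of_apply, Fin.ext_iff, Fin.val_last, Fin.val_zero, if_true]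
    split_ifs <;> first | omega | ring
  simp [hdiag]

/-- Flux differencing along one grid line: the entropy projection of the split-form derivative
equals the potential tested against the derivative of the metric term, plus boundary values. -/
theorem sum_fluxDifferencing_line {N : ℕ} (hN : 1 ≤ N) {ω : Fin (N + 1) → ℝ}
    {D Q : Matrix (Fin (N + 1)) (Fin (N + 1)) ℝ} (hQ : ∀ i m, Q i m = ω i * D i m)
    (hSBP : Q + Qᵀ = sbpBoundaryMatrix N) (hrow : ∀ i, ∑ m, Q i m = 0)
    (a ψ s : Fin (N + 1) → ℝ) (g : Fin (N + 1) → Fin (N + 1) → ℝ)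
    (hg : ∀ i m, g i m - g m i = ψ i - ψ m) (hs : ∀ i, g i i - ψ i = s i) :
    ∑ i, ω i * ∑ m, D i m * ((a i + a m) * g i m)
      = ∑ i, ω i * (ψ i * ∑ m, D i m * a m)
        + (a (Fin.last N) * s (Fin.last N) - a 0 * s 0) := by
  have hB : ∀ i m, sbpBoundaryMatrix N i m = Q i m + Q m i := fun i m => by
    rw [← hSBP]; rfl
  have hrow' : ∑ i, ∑ m, Q i m * (a i * ψ i) = 0 := by
    simp [← Finset.sum_mul, hrow]
  have e1 := sum_sum_sbpBoundaryMatrix_mul hN fun i m => (a i + a m) * g m i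
  have e2 := sum_sum_sbpBoundaryMatrix_mul hN fun i m => a m * ψ i
  have e3 := sum_sum_sbpBoundaryMatrix_mul hN fun i _ => a i * ψ i
  have c1 : ∑ i, ∑ m, Q m i * ((a i + a m) * g m i) = ∑ i, ∑ m, Q i m * ((a i + a m) * g i m) := by
    rw [Finset.sum_comm]; simp only [add_comm]
  have c2 : ∑ i, ∑ m, Q m i * (a m * ψ i) = ∑ i, ∑ m, Q i m * (a i * ψ m) := Finset.sum_comm
  have c3 : ∑ i, ∑ m, Q m i * (a i * ψ i) = ∑ i, ∑ m, Q i m * (a m * ψ m) := Finset.sum_comm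
  simp only [hB, add_mul (Q _ _), Finset.sum_add_distrib, c1, c2, c3, hrow'] at e1 e2 e3
  have key : ∑ i, ∑ m, Q i m * ((a i + a m) * g i m) - ∑ i, ∑ m, Q i m * ((a i + a m) * g m i)
      = 0 + ∑ i, ∑ m, Q i m * (a m * ψ i) - ∑ i, ∑ m, Q i m * (a i * ψ m)
        - ∑ i, ∑ m, Q i m * (a m * ψ m) := by
    rw [← hrow']
    simp only [← Finset.sum_add_distrib, ← Finset.sum_sub_distrib]
    refine Finset.sum_congr rfl fun i _ => Finset.sum_congr rfl fun m _ => ?_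
    linear_combination Q i m * (a i + a m) * hg i m
  have l1 : ∑ i, ω i * ∑ m, D i m * ((a i + a m) * g i m)
      = ∑ i, ∑ m, Q i m * ((a i + a m) * g i m) := by
    simp only [hQ, Finset.mul_sum, mul_assoc]
  have l2 : ∑ i, ω i * (ψ i * ∑ m, D i m * a m) = ∑ i, ∑ m, Q i m * (a m * ψ i) := by
    simp only [hQ, Finset.mul_sum]
    refine Finset.sum_congr rfl fun i _ => Finset.sum_congr rfl fun m _ => by ring
  rw [l1, l2, ← hs, ← hs]
  -- averaging the two orderings of the node pair
  linear_combination (key + e1 - e2 - e3) / 2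

theorem dotProduct_fluxDifferencing {ι κ ν : Type*} [Fintype ι] [Fintype κ] [Fintype ν]
    (w : ν → ℝ) (c : ι → ℝ) (b : ι → κ → ℝ) (f : κ → ι → ν → ℝ) :
    w ⬝ᵥ ∑ m, c m • ∑ d, (b m d / 2) • f d m
      = (∑ d, ∑ m, c m * (b m d * (w ⬝ᵥ f d m))) / 2 := by
  rw [Finset.sum_comm, dotProduct_sum, Finset.sum_div]
  refine Finset.sum_congr rfl fun m _ => ?_
  rw [dotProduct_smul, dotProduct_sum, smul_eq_mul, Finset.mul_sum, Finset.sum_div]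
  refine Finset.sum_congr rfl fun d _ => ?_
  rw [dotProduct_smul, smul_eq_mul]
  ring

/-- Three-dimensional curvilinear discrete entropy conservation: for a DGSEM operator
with the SBP property, symmetric consistent entropy conservative two-point fluxes, and
discretely satisfied metric identities, the entropy-projected volume term equals exactly
the discrete surface integral of the contravariant entropy flux. -/
theorem threeD_curvilinear_discrete_entropy_conservation
    (N n : ℕ) (hN : 1 ≤ N) (hn : 1 ≤ n)
    (ω : Fin (N + 1) → ℝ) (hω : ∀ i, 0 < ω i)
    (D Q : Matrix (Fin (N + 1)) (Fin (N + 1)) ℝ)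
    (hQ : ∀ i m, Q i m = ω i * D i m)
    (hSBP : Q + Qᵀ = sbpBoundaryMatrix N)
    (hrow : ∀ i, ∑ m, Q i m = 0)
    (W : Fin (N + 1) × Fin (N + 1) × Fin (N + 1) → Fin n → ℝ)
    (F : Fin 3 → Fin (N + 1) × Fin (N + 1) × Fin (N + 1) → Fin n → ℝ)
    (Fent : Fin 3 → Fin (N + 1) × Fin (N + 1) × Fin (N + 1) → ℝ)
    (Ψ : Fin 3 → Fin (N + 1) × Fin (N + 1) × Fin (N + 1) → ℝ)
    (hΨ : ∀ d α, Ψ d α = W α ⬝ᵥ F d α - Fent d α)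
    (Ja : Fin 3 → Fin (N + 1) × Fin (N + 1) × Fin (N + 1) → Fin 3 → ℝ)
    (Fec : Fin 3 → Fin (N + 1) × Fin (N + 1) × Fin (N + 1) →
      Fin (N + 1) × Fin (N + 1) × Fin (N + 1) → Fin n → ℝ)
    (hsym : ∀ d α β, Fec d α β = Fec d β α)
    (hcons : ∀ d α, Fec d α α = F d α)
    (hec : ∀ d α β, Fec d α β ⬝ᵥ (W α - W β) = Ψ d α - Ψ d β)
    (hmetric : ∀ d : Fin 3, ∀ i j k : Fin (N + 1),
      ∑ m, (D i m * Ja 0 (m, j, k) d + D j m * Ja 1 (i, m, k) d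
        + D k m * Ja 2 (i, j, m) d) = 0) :
    ∑ i, ∑ j, ∑ k, ω i * ω j * ω k *
        (W (i, j, k) ⬝ᵥ
          ((2:ℝ) •
            ((∑ m, D i m •
                ∑ d, ((Ja 0 (i, j, k) d + Ja 0 (m, j, k) d) / 2) • Fec d (i, j, k) (m, j, k))
              + (∑ m, D j m •
                ∑ d, ((Ja 1 (i, j, k) d + Ja 1 (i, m, k) d) / 2) • Fec d (i, j, k) (i, m, k))
              + (∑ m, D k m •
                ∑ d, ((Ja 2 (i, j, k) d + Ja 2 (i, j, m) d) / 2) • Fec d (i, j, k) (i, j, m)))))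
      = (∑ j, ∑ k, ω j * ω k *
            ∑ d, (Ja 0 (Fin.last N, j, k) d * Fent d (Fin.last N, j, k)
              - Ja 0 (0, j, k) d * Fent d (0, j, k)))
        + (∑ i, ∑ k, ω i * ω k *
            ∑ d, (Ja 1 (i, Fin.last N, k) d * Fent d (i, Fin.last N, k)
              - Ja 1 (i, 0, k) d * Fent d (i, 0, k)))
        + (∑ i, ∑ j, ω i * ω j *
            ∑ d, (Ja 2 (i, j, Fin.last N) d * Fent d (i, j, Fin.last N)
              - Ja 2 (i, j, 0) d * Fent d (i, j, 0))) := by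
  have hg : ∀ d α β, W α ⬝ᵥ Fec d α β - W β ⬝ᵥ Fec d β α = Ψ d α - Ψ d β := fun d α β => by
    rw [hsym d β α, ← sub_dotProduct, dotProduct_comm, hec]
  have hs : ∀ d α, W α ⬝ᵥ Fec d α α - Ψ d α = Fent d α := fun d α => by
    rw [hcons, hΨ]; ring
  have line1 := fun d j k => sum_fluxDifferencing_line hN hQ hSBP hrow
    (fun i => Ja 0 (i, j, k) d) (fun i => Ψ d (i, j, k)) (fun i => Fent d (i, j, k))
    (fun i m => W (i, j, k) ⬝ᵥ Fec d (i, j, k) (m, j, k)) (fun _ _ => hg ..) (fun _ => hs ..)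
  have line2 := fun d i k => sum_fluxDifferencing_line hN hQ hSBP hrow
    (fun j => Ja 1 (i, j, k) d) (fun j => Ψ d (i, j, k)) (fun j => Fent d (i, j, k))
    (fun j m => W (i, j, k) ⬝ᵥ Fec d (i, j, k) (i, m, k)) (fun _ _ => hg ..) (fun _ => hs ..)
  have line3 := fun d i j => sum_fluxDifferencing_line hN hQ hSBP hrow
    (fun k => Ja 2 (i, j, k) d) (fun k => Ψ d (i, j, k)) (fun k => Fent d (i, j, k))
    (fun k m => W (i, j, k) ⬝ᵥ Fec d (i, j, k) (i, j, m)) (fun _ _ => hg ..) (fun _ => hs ..)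
  have pull1 : ∀ p : Fin 3 → Fin (N + 1) → Fin (N + 1) → Fin (N + 1) → ℝ,
      ∑ i, ∑ j, ∑ k, ω i * ω j * ω k * ∑ d, p d i j k
        = ∑ j, ∑ k, ω j * ω k * ∑ d, ∑ i, ω i * p d i j k := by
    intro p
    rw [Finset.sum_comm]
    refine Finset.sum_congr rfl fun j _ => ?_
    rw [Finset.sum_comm]
    refine Finset.sum_congr rfl fun k _ => ?_
    rw [Finset.sum_comm, Finset.mul_sum]
    refine Finset.sum_congr rfl fun i _ => ?_
    rw [← Finset.mul_sum]
    ring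
  have pull2 : ∀ p : Fin 3 → Fin (N + 1) → Fin (N + 1) → Fin (N + 1) → ℝ,
      ∑ i, ∑ j, ∑ k, ω i * ω j * ω k * ∑ d, p d i j k
        = ∑ i, ∑ k, ω i * ω k * ∑ d, ∑ j, ω j * p d i j k := by
    intro p
    refine Finset.sum_congr rfl fun i _ => ?_
    rw [Finset.sum_comm]
    refine Finset.sum_congr rfl fun k _ => ?_
    rw [Finset.sum_comm, Finset.mul_sum]
    refine Finset.sum_congr rfl fun j _ => ?_
    rw [← Finset.mul_sum]
    ring
  have pull3 : ∀ p : Fin 3 → Fin (N + 1) → Fin (N + 1) → Fin (N + 1) → ℝ,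
      ∑ i, ∑ j, ∑ k, ω i * ω j * ω k * ∑ d, p d i j k
        = ∑ i, ∑ j, ω i * ω j * ∑ d, ∑ k, ω k * p d i j k := by
    intro p
    refine Finset.sum_congr rfl fun i _ => Finset.sum_congr rfl fun j _ => ?_
    rw [Finset.sum_comm, Finset.mul_sum]
    refine Finset.sum_congr rfl fun k _ => ?_
    rw [← Finset.mul_sum]
    ring
  have metric : ∑ i, ∑ j, ∑ k, ω i * ω j * ω k *
        ∑ d, Ψ d (i, j, k) * ∑ m, D i m * Ja 0 (m, j, k) d
      + ∑ i, ∑ j, ∑ k, ω i * ω j * ω k *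
        ∑ d, Ψ d (i, j, k) * ∑ m, D j m * Ja 1 (i, m, k) d
      + ∑ i, ∑ j, ∑ k, ω i * ω j * ω k *
        ∑ d, Ψ d (i, j, k) * ∑ m, D k m * Ja 2 (i, j, m) d = 0 := by
    simp only [← Finset.sum_add_distrib, ← mul_add, hmetric, mul_zero, Finset.sum_const_zero]
  simp only [dotProduct_smul, dotProduct_add, smul_eq_mul]
  simp only [dotProduct_fluxDifferencing (W _) _ _ (fun d m => Fec d _ (m, _, _)),
    dotProduct_fluxDifferencing (W _) _ _ (fun d m => Fec d _ (_, m, _)),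
    dotProduct_fluxDifferencing (W _) _ _ (fun d m => Fec d _ (_, _, m)),
    ← add_div, mul_div_cancel₀ _ (two_ne_zero' ℝ)]
  simp only [mul_add (_ * _ * _), Finset.sum_add_distrib]
  rw [pull1, pull2, pull3] at metric ⊢
  simp only [line1, line2, line3, Finset.sum_add_distrib, mul_add (_ * _)]
  linear_combination metric
end
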